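/- Let Φ = {φ_n}_{n=1}^N ⊆ ℝ^M with each φ_n ≠ 0, and define A : ℝ^M → ℝ^N by (A(x))(n) := |⟨x, φ_n⟩|². Then A is almost injective (A⁻¹(A(x)) = {x, −x} for Lebesgue-almost every x ∈ ℝ^M) if and only if Φ spans ℝ^M and for every nonempty proper subset S ⊆ {1,…,N}, rank(Φ_S) + rank(Φ_{S^c}) > M. -/

import Mathlib

open Finset RealInnerProductSpace MeasureTheory

lemma Submodule.mem_orthogonal_span_image_iff {ι E : Type*} [NormedAddCommGroup E]
    [InnerProductSpace ℝ E] (Φ : ι → E) (S : Set ι) (x : E) :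
    x ∈ (Submodule.span ℝ (Φ '' S))ᗮ ↔ ∀ n ∈ S, ⟪x, Φ n⟫ = 0 := by
  rw [Submodule.mem_orthogonal']
  constructor
  · intro h n hn
    exact h _ (Submodule.subset_span ⟨n, hn, rfl⟩)
  · intro h u hu
    induction hu using Submodule.span_induction with
    | mem u hu => obtain ⟨n, hn, rfl⟩ := hu; exact h n hn
    | zero => simp
    | add a b _ _ ha hb => rw [inner_add_right, ha, hb, add_zero]
    | smul c a _ ha => rw [inner_smul_right, ha, mul_zero]

/-- A vector that is not a sum of vectors orthogonal to complementary nonempty parts of a spanning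
family is determined up to sign by its intensity measurements against that family. -/
lemma eq_or_eq_neg_of_forall_notMem_orthogonal_sup {ι E : Type*} [Fintype ι] [DecidableEq ι]
    [NormedAddCommGroup E] [InnerProductSpace ℝ E] {Φ : ι → E} {x y : E}
    (hspan : Submodule.span ℝ (Set.range Φ) = ⊤)
    (hx : ∀ S : Finset ι, S ≠ ∅ → S ≠ Finset.univ →
      x ∉ (Submodule.span ℝ (Φ '' ↑S))ᗮ ⊔ (Submodule.span ℝ (Φ '' ↑Sᶜ))ᗮ)
    (hy : ∀ n, |⟪y, Φ n⟫| ^ 2 = |⟪x, Φ n⟫| ^ 2) : y = x ∨ y = -x := by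
  classical
  have hzero : ∀ z : E, (∀ n, ⟪z, Φ n⟫ = 0) → z = 0 := by
    intro z hz
    have h : z ∈ (Submodule.span ℝ (Φ '' Set.univ))ᗮ :=
      (Submodule.mem_orthogonal_span_image_iff Φ _ z).2 fun n _ => hz n
    rwa [Set.image_univ, hspan, Submodule.top_orthogonal_eq_bot, Submodule.mem_bot] at h
  have hcases : ∀ n, ⟪y, Φ n⟫ = ⟪x, Φ n⟫ ∨ ⟪y, Φ n⟫ = -⟪x, Φ n⟫ := by
    intro n
    have := hy n
    rw [sq_abs, sq_abs] at this
    exact sq_eq_sq_iff_eq_or_eq_neg.1 this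
  let S : Finset ι := Finset.univ.filter fun n => ⟪y, Φ n⟫ = ⟪x, Φ n⟫
  have hS : ∀ n, n ∈ S ↔ ⟪y, Φ n⟫ = ⟪x, Φ n⟫ := fun n => by simp [S]
  by_cases hne : S = ∅
  · right
    rw [← sub_eq_zero]
    refine hzero _ fun n => ?_
    have hn : n ∉ S := by simp [hne]
    rw [inner_sub_left, inner_neg_left, (hcases n).resolve_left (mt (hS n).2 hn), sub_self]
  by_cases huniv : S = Finset.univ
  · left
    rw [← sub_eq_zero]
    refine hzero _ fun n => ?_
    rw [inner_sub_left, (hS n).1 (by simp [huniv]), sub_self]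
  refine absurd ?_ (hx S hne huniv)
  have hdecomp : x = (1 / 2 : ℝ) • (x - y) + (1 / 2 : ℝ) • (x + y) := by module
  rw [hdecomp]
  refine Submodule.add_mem_sup (Submodule.smul_mem _ _ ?_) (Submodule.smul_mem _ _ ?_)
  · refine (Submodule.mem_orthogonal_span_image_iff Φ _ _).2 fun n hn => ?_
    rw [inner_sub_left, (hS n).1 (Finset.mem_coe.1 hn), sub_self]
  · refine (Submodule.mem_orthogonal_span_image_iff Φ _ _).2 fun n hn => ?_
    have hn' : n ∉ S := by simpa using hn
    rw [inner_add_left, (hcases n).resolve_left (mt (hS n).2 hn'), add_neg_cancel]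

lemma Submodule.orthogonal_sup_orthogonal_eq_top {E : Type*} [NormedAddCommGroup E]
    [InnerProductSpace ℝ E] [FiniteDimensional ℝ E] {P Q : Submodule ℝ E} (hsup : P ⊔ Q = ⊤)
    (hrank : Module.finrank ℝ P + Module.finrank ℝ Q ≤ Module.finrank ℝ E) :
    Pᗮ ⊔ Qᗮ = ⊤ := by
  have hinf : Pᗮ ⊓ Qᗮ = ⊥ := by
    rw [Submodule.inf_orthogonal, hsup, Submodule.top_orthogonal_eq_bot]
  have h := Submodule.finrank_sup_add_finrank_inf_eq Pᗮ Qᗮ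
  rw [hinf, finrank_bot] at h
  have hP := P.finrank_add_finrank_orthogonal
  have hQ := Q.finrank_add_finrank_orthogonal
  have hle := (Pᗮ ⊔ Qᗮ).finrank_le
  exact Submodule.eq_top_of_finrank_eq (by omega)

lemma Submodule.orthogonal_sup_orthogonal_ne_top {E : Type*} [NormedAddCommGroup E]
    [InnerProductSpace ℝ E] [FiniteDimensional ℝ E] {P Q : Submodule ℝ E}
    (hrank : Module.finrank ℝ E < Module.finrank ℝ P + Module.finrank ℝ Q) :
    Pᗮ ⊔ Qᗮ ≠ ⊤ := by
  intro htop
  have h := Submodule.finrank_sup_add_finrank_inf_eq Pᗮ Qᗮ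
  rw [htop, finrank_top] at h
  have hP := P.finrank_add_finrank_orthogonal
  have hQ := Q.finrank_add_finrank_orthogonal
  omega

lemma Submodule.ae_notMem_of_ne_top {E : Type*} [NormedAddCommGroup E] [NormedSpace ℝ E]
    [FiniteDimensional ℝ E] [MeasurableSpace E] [BorelSpace E] (μ : Measure E)
    [μ.IsAddHaarMeasure] {P : Submodule ℝ E} (hP : P ≠ ⊤) : ∀ᵐ x ∂μ, x ∉ P :=
  measure_eq_zero_iff_ae_notMem.1 (Measure.addHaar_submodule μ P hP)

lemma orthogonal_span_image_ne_top {ι E : Type*} [NormedAddCommGroup E] [InnerProductSpace ℝ E]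
    {Φ : ι → E} (hne : ∀ n, Φ n ≠ 0) {S : Set ι} (hS : S.Nonempty) :
    (Submodule.span ℝ (Φ '' S))ᗮ ≠ ⊤ := by
  obtain ⟨n, hn⟩ := hS
  intro h
  have hmem : Φ n ∈ (Submodule.span ℝ (Φ '' S))ᗮ := h ▸ Submodule.mem_top
  exact hne n (inner_self_eq_zero.1 ((Submodule.mem_orthogonal_span_image_iff Φ S _).1 hmem n hn))

theorem almost_injective_iff_rank_sum (M N : ℕ)
    (Φ : Fin N → EuclideanSpace ℝ (Fin M))
    (hne : ∀ n, Φ n ≠ 0) :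
    (∀ᵐ x ∂(volume : Measure (EuclideanSpace ℝ (Fin M))),
        ∀ y : EuclideanSpace ℝ (Fin M),
          (∀ n, |⟪y, Φ n⟫|^2 = |⟪x, Φ n⟫|^2) → y = x ∨ y = -x) ↔
    (Submodule.span ℝ (Set.range Φ) = ⊤ ∧
      ∀ S : Finset (Fin N), S ≠ ∅ → S ≠ Finset.univ →
        M < Module.finrank ℝ (Submodule.span ℝ (Φ '' ↑S)) +
              Module.finrank ℝ (Submodule.span ℝ (Φ '' ↑Sᶜ))) := by
  have hdim : Module.finrank ℝ (EuclideanSpace ℝ (Fin M)) = M := finrank_euclideanSpace_fin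
  constructor
  · intro hae
    have hspan : Submodule.span ℝ (Set.range Φ) = ⊤ := by
      by_contra hspan
      have hperp : (Submodule.span ℝ (Set.range Φ))ᗮ ≠ ⊥ :=
        mt Submodule.orthogonal_eq_bot_iff.1 hspan
      obtain ⟨w, hw, hw0⟩ := Submodule.exists_mem_ne_zero_of_ne_bot hperp
      rw [← Set.image_univ] at hw
      have hwΦ := (Submodule.mem_orthogonal_span_image_iff Φ _ w).1 hw
      obtain ⟨x, hx⟩ := hae.exists
      have hshift : ∀ c : ℝ, c ≠ 0 → x + c • w = -x := by
        intro c hc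
        refine (hx (x + c • w) fun n => ?_).resolve_left fun h => ?_
        · rw [inner_add_left, real_inner_smul_left, hwΦ n trivial, mul_zero, add_zero]
        · exact (smul_ne_zero hc hw0) (add_eq_left.1 h)
      have h := (hshift 1 one_ne_zero).trans (hshift 2 two_ne_zero).symm
      exact absurd (smul_left_injective ℝ hw0 (add_left_cancel h)) (by norm_num)
    refine ⟨hspan, fun S hS hSuniv => ?_⟩
    by_contra! hrank
    have hsup : Submodule.span ℝ (Φ '' ↑S) ⊔ Submodule.span ℝ (Φ '' ↑Sᶜ) = ⊤ := by
      rw [← Submodule.span_union, ← Set.image_union, ← Finset.coe_union, Finset.union_compl,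
        Finset.coe_univ, Set.image_univ, hspan]
    have htop := Submodule.orthogonal_sup_orthogonal_eq_top hsup (hrank.trans_eq hdim.symm)
    have hSc : (Sᶜ).Nonempty := by
      rwa [Finset.nonempty_iff_ne_empty, Ne, Finset.compl_eq_empty_iff]
    have hP := Submodule.ae_notMem_of_ne_top (volume : Measure (EuclideanSpace ℝ (Fin M)))
      (orthogonal_span_image_ne_top hne
        (Finset.coe_nonempty.2 (Finset.nonempty_iff_ne_empty.2 hS)))
    have hQ := Submodule.ae_notMem_of_ne_top (volume : Measure (EuclideanSpace ℝ (Fin M)))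
      (orthogonal_span_image_ne_top hne (Finset.coe_nonempty.2 hSc))
    obtain ⟨x, ⟨hx, hxP⟩, hxQ⟩ := ((hae.and hP).and hQ).exists
    obtain ⟨u, hu, v, hv, rfl⟩ := Submodule.mem_sup.1 (htop ▸ Submodule.mem_top (x := x))
    have huΦ := (Submodule.mem_orthogonal_span_image_iff Φ _ u).1 hu
    have hvΦ := (Submodule.mem_orthogonal_span_image_iff Φ _ v).1 hv
    have hmeas : ∀ n, |⟪u - v, Φ n⟫| ^ 2 = |⟪u + v, Φ n⟫| ^ 2 := by
      intro n
      rw [inner_sub_left, inner_add_left]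
      by_cases hn : n ∈ S
      · rw [huΦ n hn, zero_sub, zero_add, abs_neg]
      · rw [hvΦ n (by simpa using hn), sub_zero, add_zero]
    rcases hx (u - v) hmeas with h | h
    · have hv0 : v = 0 := by
        have : (2 : ℝ) • v = 0 := by linear_combination (norm := module) -h
        simpa using this
      exact hxP (by simpa [hv0] using hu)
    · have hu0 : u = 0 := by
        have : (2 : ℝ) • u = 0 := by linear_combination (norm := module) h
        simpa using this
      exact hxQ (by simpa [hu0] using hv)
  · rintro ⟨hspan, hrank⟩
    have hnot : ∀ᵐ x ∂(volume : Measure (EuclideanSpace ℝ (Fin M))),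
        ∀ S : Finset (Fin N), S ≠ ∅ → S ≠ Finset.univ →
          x ∉ (Submodule.span ℝ (Φ '' ↑S))ᗮ ⊔ (Submodule.span ℝ (Φ '' ↑Sᶜ))ᗮ := by
      refine ae_all_iff.2 fun S => ?_
      by_cases hS : S = ∅ ∨ S = Finset.univ
      · exact .of_forall fun x h1 h2 => (hS.elim h1 h2).elim
      · push Not at hS
        have h := Submodule.orthogonal_sup_orthogonal_ne_top
          (hdim.trans_lt (hrank S hS.1.ne_empty hS.2))
        filter_upwards [Submodule.ae_notMem_of_ne_top volume h] with x hx _ _ using hx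
    filter_upwards [hnot] with x hx y hy
    exact eq_or_eq_neg_of_forall_notMem_orthogonal_sup hspan hx hy
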